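/- Fix integers d_i > d_j ≥ 1 and 0 ≤ r < d_j, and set a q = ((q+1) * d_i − 1 − r) / d_j (natural number division). Then for all m q : ℕ, m belongs to the interval S q if and only if (m * d_j + r) / d_i = q (natural number division). In particular, if m₁ ∈ S q and m₂ : ℕ satisfies (m₁ * d_j + r) / d_i = (m₂ * d_j + r) / d_i, then m₂ ∈ S q, and the sets S q, q : ℕ, partition ℕ. -/

import Mathlib

/-- `a q = ((q+1) * d_i − 1 − r) / d_j` (natural number division). -/
def aFun (d_i d_j r q : ℕ) : ℕ := ((q + 1) * d_i - 1 - r) / d_j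

/-- The intervals `S 0 = {0, …, a 0}` and `S (q+1) = {a q + 1, …, a (q+1)}`. -/
def Sset (d_i d_j r : ℕ) : ℕ → Finset ℕ
  | 0 => Finset.Iic (aFun d_i d_j r 0)
  | (q + 1) => Finset.Ioc (aFun d_i d_j r q) (aFun d_i d_j r (q + 1))

theorem le_aFun_iff (d_i d_j r : ℕ) (h1 : 1 ≤ d_j) (h2 : d_j < d_i) (hr : r < d_j) (m q : ℕ) :
    m ≤ aFun d_i d_j r q ↔ (m * d_j + r) / d_i < q + 1 := by
  unfold aFun
  rw [Nat.le_div_iff_mul_le (by omega), Nat.div_lt_iff_lt_mul (by omega)]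
  have : d_i ≤ (q + 1) * d_i := Nat.le_mul_of_pos_left _ (by omega)
  omega

/-- `m ∈ S q` if and only if `(m * d_j + r) / d_i = q`; in particular membership in `S q` is
stable under equality of the quotients, and the sets `S q` partition `ℕ`. -/
theorem Sset_mem_iff_div (d_i d_j r : ℕ) (h1 : 1 ≤ d_j) (h2 : d_j < d_i) (hr : r < d_j) :
    (∀ m q : ℕ, m ∈ Sset d_i d_j r q ↔ (m * d_j + r) / d_i = q) ∧
    (∀ q m₁ m₂ : ℕ, m₁ ∈ Sset d_i d_j r q →
      (m₁ * d_j + r) / d_i = (m₂ * d_j + r) / d_i → m₂ ∈ Sset d_i d_j r q) ∧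
    (∀ m : ℕ, ∃! q : ℕ, m ∈ Sset d_i d_j r q) := by
  have key : ∀ m q : ℕ, m ∈ Sset d_i d_j r q ↔ (m * d_j + r) / d_i = q := by
    intro m q
    have h := le_aFun_iff d_i d_j r h1 h2 hr m
    generalize (m * d_j + r) / d_i = t at h ⊢
    cases q with
    | zero =>
      rw [Sset, Finset.mem_Iic, h]
      omega
    | succ q =>
      rw [Sset, Finset.mem_Ioc, h, ← not_le, h]
      omega
  refine ⟨key, ?_, ?_⟩
  · intro q m₁ m₂ hm he
    rw [key] at hm ⊢
    rw [← he, hm]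
  · intro m
    exact ⟨_, (key m _).2 rfl, fun q hq => ((key m q).1 hq).symm⟩
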